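/- arXiv:2504.15847 — 7 statements merged into one kernel-verified Lean document; each statement's English description precedes it below -/
import Mathlib

section
/- (Approximation guarantee of CARE-CO; part of Theorem 1.) Assume the CARE-CO setup with truthful bids (each worker's bid equals its true cost), k < n, and M_v(S_k) ≥ min_{i ≤ n} v i. Then every compatibility-feasible assignment x on the full worker set whose total cost ∑_{i selected} b i is at most B satisfies ∑_{i selected} v i ≤ (2 + (max_{i ≤ n} v i)/(min_{i ≤ n} v i)) · M_v(S_k). In other words, CARE-CO is (2 + v_max/v_min)-approximate against the optimal overall reputation achievable with known costs under the budget B and the compatibility constraints. -/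
/-- The set of selected workers of a partial assignment `x`. -/
def selected {n m : ℕ} (x : Fin n → Option (Fin m)) : Finset (Fin n) :=
  Finset.univ.filter fun i => x i ≠ none

/-- `x` is compatibility-feasible on `S`: every selected worker lies in `S`, and for each
group `l` and requester `j`, at most `τ l j` workers of group `l` are assigned to `j`. -/
def CompatFeasible {n m L : ℕ} (g : Fin n → Fin L) (τ : Fin L → Fin m → ℕ)
    (S : Finset (Fin n)) (x : Fin n → Option (Fin m)) : Prop :=
  (∀ i, x i ≠ none → i ∈ S) ∧
  ∀ (l : Fin L) (j : Fin m),
    (Finset.univ.filter fun i => g i = l ∧ x i = some j).card ≤ τ l j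

lemma compatFeasible_none {n m L : ℕ} (g : Fin n → Fin L) (τ : Fin L → Fin m → ℕ)
    (S : Finset (Fin n)) : CompatFeasible g τ S (fun _ => (none : Option (Fin m))) := by
  refine ⟨fun i h => absurd rfl h, fun l j => ?_⟩
  simp

open Classical in
/-- `Mv g τ v S`: the optimal overall reputation over compatibility-feasible assignments
on `S`. -/
noncomputable def Mv {n m L : ℕ} (g : Fin n → Fin L) (τ : Fin L → Fin m → ℕ)
    (v : Fin n → ℝ) (S : Finset (Fin n)) : ℝ :=
  (Finset.univ.filter fun x : Fin n → Option (Fin m) => CompatFeasible g τ S x).sup'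
    ⟨fun _ => none, Finset.mem_filter.mpr ⟨Finset.mem_univ _, compatFeasible_none g τ S⟩⟩
    fun x => ∑ i ∈ selected x, v i

/-- The set of the first `j` workers (0-indexed: workers `0, …, j-1`). -/
def firstWorkers (n j : ℕ) : Finset (Fin n) := Finset.univ.filter fun i => (i : ℕ) < j

lemma CompatFeasible.sum_le_Mv {n m L : ℕ} {g : Fin n → Fin L} {τ : Fin L → Fin m → ℕ}
    {S : Finset (Fin n)} {x : Fin n → Option (Fin m)} (hx : CompatFeasible g τ S x)
    (v : Fin n → ℝ) : ∑ i ∈ selected x, v i ≤ Mv g τ v S := by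
  classical
  exact Finset.le_sup' (fun x : Fin n → Option (Fin m) => ∑ i ∈ selected x, v i)
    (Finset.mem_filter.mpr ⟨Finset.mem_univ x, hx⟩)

/-- Unassigning the workers outside `T` bounds the reputation collected inside `T`. -/
lemma CompatFeasible.sum_filter_le_Mv {n m L : ℕ} {g : Fin n → Fin L}
    {τ : Fin L → Fin m → ℕ} {S : Finset (Fin n)} {x : Fin n → Option (Fin m)}
    (hx : CompatFeasible g τ S x) (v : Fin n → ℝ) (T : Finset (Fin n)) :
    ∑ i ∈ (selected x).filter (· ∈ T), v i ≤ Mv g τ v T := by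
  have hy : CompatFeasible g τ T (fun i => if i ∈ T then x i else none) := by
    refine ⟨fun i hi => ?_, fun l j => le_trans (Finset.card_le_card ?_) (hx.2 l j)⟩
    · by_contra h
      simp [h] at hi
    · intro i
      by_cases h : i ∈ T <;> simp [h]
  convert hy.sum_le_Mv v using 2
  ext i
  by_cases h : i ∈ T <;> simp [selected, h]

/-- Adding one worker increases the optimal reputation by at most that worker's reputation. -/
lemma Mv_firstWorkers_succ_le {n m L : ℕ} (g : Fin n → Fin L) (τ : Fin L → Fin m → ℕ)
    (v : Fin n → ℝ) (hv : ∀ i, 0 < v i) {k : ℕ} (hk : k < n) :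
    Mv g τ v (firstWorkers n (k + 1)) ≤ Mv g τ v (firstWorkers n k) + v ⟨k, hk⟩ := by
  classical
  refine Finset.sup'_le _ _ fun x hx => ?_
  replace hx := (Finset.mem_filter.mp hx).2
  rw [← Finset.sum_filter_add_sum_filter_not (selected x) (· ∈ firstWorkers n k)]
  refine add_le_add (hx.sum_filter_le_Mv v _) ?_
  rw [← Finset.sum_singleton v ⟨k, hk⟩]
  refine Finset.sum_le_sum_of_subset_of_nonneg (fun i hi => ?_) fun i _ _ => (hv i).le
  simp only [Finset.mem_filter, selected, firstWorkers, Finset.mem_univ, true_and] at hi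
  have h := hx.1 i hi.1
  simp only [firstWorkers, Finset.mem_filter, Finset.mem_univ, true_and] at h
  rw [Finset.mem_singleton, Fin.ext_iff]
  dsimp only
  omega

/-- Approximation guarantee of CARE-CO (part of Theorem 1): in the CARE-CO setup with
truthful bids (the bids `b` are the true costs), `k < n`, and `Mv(S_k) ≥ min_i v i`,
every compatibility-feasible assignment on the full worker set whose total selected cost
is at most `B` obtains overall reputation at most
`(2 + v_max / v_min) · Mv(S_k)`. -/
theorem careCO_approximation
    {n m L : ℕ} (g : Fin n → Fin L) (τ : Fin L → Fin m → ℕ)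
    (b v : Fin n → ℝ) (hb : ∀ i, 0 < b i) (hv : ∀ i, 0 < v i)
    (hsort : ∀ i i' : Fin n, i ≤ i' → b i / v i ≤ b i' / v i')
    (B : ℝ) (hB : 0 < B) (k : ℕ) (hk : k < n)
    (hkey₁ : ∀ i : Fin n, (i : ℕ) < k → b i / v i * Mv g τ v (firstWorkers n k) ≤ B)
    (hkey₂ : B < b ⟨k, hk⟩ / v ⟨k, hk⟩ * Mv g τ v (firstWorkers n (k + 1)))
    (hM : Finset.univ.inf' ⟨⟨k, hk⟩, Finset.mem_univ _⟩ v ≤ Mv g τ v (firstWorkers n k)) :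
    ∀ x : Fin n → Option (Fin m), CompatFeasible g τ Finset.univ x →
      (∑ i ∈ selected x, b i) ≤ B →
      ∑ i ∈ selected x, v i ≤
        (2 + (Finset.univ.sup' ⟨⟨k, hk⟩, Finset.mem_univ _⟩ v) /
          (Finset.univ.inf' ⟨⟨k, hk⟩, Finset.mem_univ _⟩ v)) *
          Mv g τ v (firstWorkers n k) := by
  intro x hx hcost
  have hinf : 0 < Finset.univ.inf' ⟨⟨k, hk⟩, Finset.mem_univ _⟩ v :=
    (Finset.lt_inf'_iff _).2 fun i _ => hv i
  have hsup : v ⟨k, hk⟩ ≤ Finset.univ.sup' ⟨⟨k, hk⟩, Finset.mem_univ _⟩ v :=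
    Finset.le_sup' v (Finset.mem_univ _)
  set vmin := Finset.univ.inf' ⟨⟨k, hk⟩, Finset.mem_univ _⟩ v
  set vmax := Finset.univ.sup' ⟨⟨k, hk⟩, Finset.mem_univ _⟩ v
  set ρ := b ⟨k, hk⟩ / v ⟨k, hk⟩
  have hρ : 0 < ρ := div_pos (hb _) (hv _)
  have hlow := hx.sum_filter_le_Mv v (firstWorkers n k)
  have hhigh : ρ * ∑ i ∈ (selected x).filter (· ∉ firstWorkers n k), v i ≤ B := by
    rw [Finset.mul_sum]
    calc _ ≤ ∑ i ∈ (selected x).filter (· ∉ firstWorkers n k), b i := by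
          refine Finset.sum_le_sum fun i hi => (le_div_iff₀ (hv i)).1 (hsort _ _ ?_)
          simpa [firstWorkers, Fin.le_def] using (Finset.mem_filter.mp hi).2
      _ ≤ ∑ i ∈ selected x, b i :=
          Finset.sum_le_sum_of_subset_of_nonneg (Finset.filter_subset _ _)
            fun i _ _ => (hb i).le
      _ ≤ B := hcost
  have hrest := lt_of_mul_lt_mul_left (hhigh.trans_lt hkey₂) hρ.le
  have hsucc := Mv_firstWorkers_succ_le g τ v hv hk
  have hmax : vmax ≤ vmax / vmin * Mv g τ v (firstWorkers n k) := by
    rw [div_mul_eq_mul_div, le_div_iff₀ hinf]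
    exact mul_le_mul_of_nonneg_left hM ((hv _).le.trans hsup)
  rw [← Finset.sum_filter_add_sum_filter_not (selected x) (· ∈ firstWorkers n k), add_mul]
  linarith
end

section
/- (Truthfulness of CARE-CO; part of Theorem 1.) Fix n workers with positive reputations v, groups g, thresholds τ, pooled budget B > 0, and a selector F that maps every finite set S of workers to a compatibility-feasible assignment on S whose total reputation equals M_v(S) (F depends only on the set S, not on bids). CARE-CO with selector F on a profile of positive bids b works as follows: sort workers by the ratio b i / v i in nondecreasing order, breaking ties by worker index; let P_j be the set of the first j workers in this order and r_j the j-th smallest ratio; let k be the largest j ∈ {0,…,n} such that r_{j'} · M_v(P_{j'}) ≤ B for all j' ≤ j; the winners are the selected workers of F(P_k); each winner i is paid v i · θ, where θ = min(r_{k+1}, B / M_v(P_k)) if k < n and θ = B / M_v(P_k) if k = n; non-winners are paid 0. The utility of worker i with true cost c i > 0 is its payment minus c i if it is a winner and 0 otherwise. Then CARE-CO is truthful: for every worker i, every true cost c i > 0, every fixed profile of the other workers' bids, and every deviation b i' > 0, the utility of worker i when bidding c i is at least its utility when bidding b i'. -/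
/-- The ratio `b/v` of the `t`-th worker (0-indexed) in nondecreasing order of the
ratios `b i / v i`, ties broken by worker index (`Tuple.sort` sorts the graph
`(b i / v i, i)` lexicographically). -/
noncomputable def nthRatio {n : ℕ} (v b : Fin n → ℝ) (t : Fin n) : ℝ :=
  b (Tuple.sort (fun i => b i / v i) t) / v (Tuple.sort (fun i => b i / v i) t)

/-- `prefixSet v b j`: the set of the first `j` workers in nondecreasing order of the
ratios `b i / v i`, ties broken by worker index. -/
noncomputable def prefixSet {n : ℕ} (v b : Fin n → ℝ) (j : ℕ) : Finset (Fin n) :=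
  (Finset.univ.filter fun t : Fin n => (t : ℕ) < j).image
    (Tuple.sort (fun i => b i / v i))

open Classical in
/-- The key index of CARE-CO: the largest `j ∈ {0,…,n}` such that for every `j' ≤ j`
(with `j' ≥ 1`) the `j'`-th smallest ratio `r_{j'}` satisfies
`r_{j'} · Mv(P_{j'}) ≤ B`.  (Below, `t : Fin n` with `(t : ℕ) < j` ranges over the
0-indexed positions `j' - 1`.) -/
noncomputable def keyIndex {n m L : ℕ} (g : Fin n → Fin L) (τ : Fin L → Fin m → ℕ)
    (v b : Fin n → ℝ) (B : ℝ) : ℕ :=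
  ((Finset.range (n + 1)).filter fun j =>
      ∀ t : Fin n, (t : ℕ) < j →
        nthRatio v b t * Mv g τ v (prefixSet v b ((t : ℕ) + 1)) ≤ B).max'
    ⟨0, Finset.mem_filter.mpr ⟨Finset.mem_range.mpr (Nat.succ_pos n),
        fun t ht => absurd ht (Nat.not_lt_zero _)⟩⟩

/-- The unit price `θ` of CARE-CO: `min(r_{k+1}, B / Mv(P_k))` when `k < n`, and
`B / Mv(P_k)` when `k = n`. -/
noncomputable def careCoPrice {n m L : ℕ} (g : Fin n → Fin L) (τ : Fin L → Fin m → ℕ)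
    (v b : Fin n → ℝ) (B : ℝ) : ℝ :=
  if hk : keyIndex g τ v b B < n then
    min (nthRatio v b ⟨keyIndex g τ v b B, hk⟩)
      (B / Mv g τ v (prefixSet v b (keyIndex g τ v b B)))
  else B / Mv g τ v (prefixSet v b (keyIndex g τ v b B))

/-- The utility of worker `i` with true cost `c` under CARE-CO with selector `F` on the
bid profile `b`: its payment `v i · θ` minus `c` if it is a winner (a selected worker of
`F(P_k)`), and `0` otherwise. -/
noncomputable def careCoUtility {n m L : ℕ} (g : Fin n → Fin L) (τ : Fin L → Fin m → ℕ)
    (v : Fin n → ℝ) (F : Finset (Fin n) → (Fin n → Option (Fin m))) (B : ℝ)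
    (b : Fin n → ℝ) (i : Fin n) (c : ℝ) : ℝ :=
  if i ∈ selected (F (prefixSet v b (keyIndex g τ v b B))) then
    v i * careCoPrice g τ v b B - c
  else 0

/-- The workers weakly before `w` in nondecreasing order of the ratios `ρ`, ties broken by
index. -/
noncomputable def initialSegment {n : ℕ} (ρ : Fin n → ℝ) (w : Fin n) : Finset (Fin n) :=
  Finset.univ.filter fun u => ρ u < ρ w ∨ ρ u = ρ w ∧ u ≤ w

/-- The workers `w` whose ratio is affordable, within budget `B`, for the value `M` of their
initial segment. -/
noncomputable def affordable {n : ℕ} (M : Finset (Fin n) → ℝ) (B : ℝ) (ρ : Fin n → ℝ) :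
    Finset (Fin n) :=
  Finset.univ.filter fun w => ρ w * M (initialSegment ρ w) ≤ B

/-- The unit price determined by the candidate set `S` and the ratios of the workers
outside `S`. -/
noncomputable def unitPrice {n : ℕ} (M : Finset (Fin n) → ℝ) (B : ℝ) (ρ : Fin n → ℝ)
    (S : Finset (Fin n)) : ℝ :=
  if h : Sᶜ.Nonempty then min (Sᶜ.inf' h ρ) (B / M S) else B / M S

lemma mem_initialSegment {n : ℕ} {ρ : Fin n → ℝ} {u w : Fin n} :
    u ∈ initialSegment ρ w ↔ ρ u < ρ w ∨ ρ u = ρ w ∧ u ≤ w := by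
  simp [initialSegment]

lemma mem_affordable {n : ℕ} {M : Finset (Fin n) → ℝ} {B : ℝ} {ρ : Fin n → ℝ} {w : Fin n} :
    w ∈ affordable M B ρ ↔ ρ w * M (initialSegment ρ w) ≤ B := by
  simp [affordable]

lemma le_of_mem_initialSegment {n : ℕ} {ρ : Fin n → ℝ} {u w : Fin n}
    (h : u ∈ initialSegment ρ w) : ρ u ≤ ρ w := by
  rcases mem_initialSegment.mp h with h | h
  · exact h.le
  · exact h.1.le

lemma initialSegment_subset {n : ℕ} {ρ : Fin n → ℝ} {u w : Fin n}
    (h : u ∈ initialSegment ρ w) : initialSegment ρ u ⊆ initialSegment ρ w := by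
  intro x hx
  rw [mem_initialSegment] at *
  grind

lemma mem_initialSegment_total {n : ℕ} (ρ : Fin n → ℝ) (u w : Fin n) :
    u ∈ initialSegment ρ w ∨ w ∈ initialSegment ρ u := by
  simp only [mem_initialSegment]
  grind

lemma affordable_of_mem_initialSegment {n : ℕ} {M : Finset (Fin n) → ℝ} (hM : Monotone M)
    (hM0 : ∀ S, 0 ≤ M S) {B : ℝ} {ρ : Fin n → ℝ} (hρ : ∀ j, 0 < ρ j) {u w : Fin n}
    (h : u ∈ initialSegment ρ w) (hw : w ∈ affordable M B ρ) : u ∈ affordable M B ρ := by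
  rw [mem_affordable] at *
  exact (mul_le_mul (le_of_mem_initialSegment h) (hM (initialSegment_subset h)) (hM0 _)
    (hρ w).le).trans hw

/-- Lowering the ratio of an affordable worker does not change the affordable set. -/
lemma affordable_eq_of_le {n : ℕ} {M : Finset (Fin n) → ℝ} (hM : Monotone M)
    (hM0 : ∀ S, 0 ≤ M S) {B : ℝ} {ρ ρ' : Fin n → ℝ} (hρ : ∀ j, 0 < ρ j)
    {i : Fin n} (hne : ∀ j, j ≠ i → ρ' j = ρ j) (hle : ρ' i ≤ ρ i)
    (hi : i ∈ affordable M B ρ) : affordable M B ρ' = affordable M B ρ := by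
  have bound : ∀ w, ρ' w ≤ ρ i → initialSegment ρ' w ⊆ initialSegment ρ i →
      w ∈ affordable M B ρ' := fun w h1 h2 => by
    rw [mem_affordable] at *
    exact (mul_le_mul h1 (hM h2) (hM0 _) (hρ i).le).trans hi
  have hii : i ∈ affordable M B ρ' := by
    refine bound i hle fun u hu => ?_
    rw [mem_initialSegment] at *
    have := hne u
    grind
  ext w
  by_cases hwi : w = i
  · subst hwi
    simp [hi, hii]
  have hw := hne w hwi
  by_cases hb : w ∈ initialSegment ρ i
  · refine iff_of_true (bound w ?_ fun u hu => ?_)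
      (affordable_of_mem_initialSegment hM hM0 hρ hb hi)
    · rw [hw]
      exact le_of_mem_initialSegment hb
    · rw [mem_initialSegment] at *
      have := hne u
      grind
  · have hseg : initialSegment ρ' w = initialSegment ρ w := by
      ext u
      rw [mem_initialSegment] at *
      rw [mem_initialSegment]
      have := hne u
      grind
    rw [mem_affordable, mem_affordable, hseg, hw]

lemma unitPrice_congr {n : ℕ} (M : Finset (Fin n) → ℝ) (B : ℝ) {ρ ρ' : Fin n → ℝ}
    {S : Finset (Fin n)} (h : ∀ j, j ∉ S → ρ' j = ρ j) :
    unitPrice M B ρ' S = unitPrice M B ρ S := by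
  unfold unitPrice
  split_ifs with hS
  · rw [Finset.inf'_congr hS rfl fun j hj => h j (Finset.mem_compl.mp hj)]
  · rfl

lemma lt_unitPrice_iff {n : ℕ} {M : Finset (Fin n) → ℝ} {B : ℝ} {ρ : Fin n → ℝ}
    {S : Finset (Fin n)} {x : ℝ} :
    x < unitPrice M B ρ S ↔ (∀ j, j ∉ S → x < ρ j) ∧ x < B / M S := by
  unfold unitPrice
  split_ifs with hS
  · simp [Finset.lt_inf'_iff]
  · have : ∀ j, j ∈ S := by simpa [Finset.Nonempty] using hS
    simp [this]

lemma le_unitPrice_iff {n : ℕ} {M : Finset (Fin n) → ℝ} {B : ℝ} {ρ : Fin n → ℝ}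
    {S : Finset (Fin n)} {x : ℝ} :
    x ≤ unitPrice M B ρ S ↔ (∀ j, j ∉ S → x ≤ ρ j) ∧ x ≤ B / M S := by
  unfold unitPrice
  split_ifs with hS
  · simp [Finset.le_inf'_iff]
  · have : ∀ j, j ∈ S := by simpa [Finset.Nonempty] using hS
    simp [this]

lemma affordable_subset_initialSegment {n : ℕ} {M : Finset (Fin n) → ℝ} {B : ℝ}
    {ρ : Fin n → ℝ} (hne : (affordable M B ρ).Nonempty) :
    ∃ w ∈ affordable M B ρ, affordable M B ρ ⊆ initialSegment ρ w := by
  obtain ⟨w, hw, hmax⟩ := (affordable M B ρ).exists_max_image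
    (fun u => toLex (ρ u, u)) hne
  refine ⟨w, hw, fun u hu => mem_initialSegment.mpr ?_⟩
  simpa [Prod.Lex.le_iff] using hmax u hu

/-- Individual rationality: the ratio of an affordable worker is at most the unit price. -/
lemma le_unitPrice_of_mem_affordable {n : ℕ} {M : Finset (Fin n) → ℝ} (hM : Monotone M)
    (hM0 : ∀ S, 0 ≤ M S) {B : ℝ} {ρ : Fin n → ℝ} (hρ : ∀ j, 0 < ρ j) {i : Fin n}
    (hi : i ∈ affordable M B ρ) (hpos : 0 < M (affordable M B ρ)) :
    ρ i ≤ unitPrice M B ρ (affordable M B ρ) := by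
  refine le_unitPrice_iff.mpr ⟨fun j hj => ?_, ?_⟩
  · rcases mem_initialSegment_total ρ i j with h | h
    · exact le_of_mem_initialSegment h
    · exact absurd (affordable_of_mem_initialSegment hM hM0 hρ h hi) hj
  · obtain ⟨w, hw, hsub⟩ := affordable_subset_initialSegment ⟨i, hi⟩
    rw [le_div_iff₀ hpos]
    exact (mul_le_mul (le_of_mem_initialSegment (hsub hi)) (hM hsub) (hM0 _) (hρ w).le).trans
      (mem_affordable.mp hw)

/-- A worker whose ratio, raised to `ρ i`, is below the unit price stays affordable. -/
lemma mem_affordable_of_lt_unitPrice {n : ℕ} {M : Finset (Fin n) → ℝ} (hM : Monotone M)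
    {B : ℝ} {ρ ρ' : Fin n → ℝ} (hρ : ∀ j, 0 < ρ j) {S : Finset (Fin n)} {i : Fin n}
    (hne : ∀ j, j ≠ i → ρ' j = ρ j) (hi : i ∈ S) (hpos : 0 < M S)
    (hlt : ρ i < unitPrice M B ρ' S) : i ∈ affordable M B ρ := by
  obtain ⟨h1, h2⟩ := lt_unitPrice_iff.mp hlt
  have hsub : initialSegment ρ i ⊆ S := fun u hu => by
    by_contra huS
    have hui : u ≠ i := fun h => huS (h ▸ hi)
    have := h1 u huS
    rw [hne u hui] at this
    exact this.not_ge (le_of_mem_initialSegment hu)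
  rw [lt_div_iff₀ hpos] at h2
  exact mem_affordable.mpr ((mul_le_mul_of_nonneg_left (hM hsub) (hρ i).le).trans h2.le)

lemma Mv_mono {n m L : ℕ} (g : Fin n → Fin L) (τ : Fin L → Fin m → ℕ) (v : Fin n → ℝ) :
    Monotone (Mv g τ v) := fun S T hST => by
  classical
  unfold Mv
  refine Finset.sup'_mono (fun x : Fin n → Option (Fin m) => ∑ i ∈ selected x, v i)
    (fun x hx => ?_) _
  simp only [Finset.mem_filter, Finset.mem_univ, true_and] at hx ⊢
  exact ⟨fun i hi => hST (hx.1 i hi), hx.2⟩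

lemma Mv_nonneg {n m L : ℕ} (g : Fin n → Fin L) (τ : Fin L → Fin m → ℕ) (v : Fin n → ℝ)
    (S : Finset (Fin n)) : 0 ≤ Mv g τ v S := by
  classical
  refine le_trans ?_ (Finset.le_sup' (fun x : Fin n → Option (Fin m) => ∑ i ∈ selected x, v i)
    (Finset.mem_filter.mpr ⟨Finset.mem_univ _, compatFeasible_none g τ S⟩))
  simp [selected]

lemma sort_mem_initialSegment_iff {n : ℕ} (f : Fin n → ℝ) (s t : Fin n) :
    Tuple.sort f s ∈ initialSegment f (Tuple.sort f t) ↔ s ≤ t := by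
  obtain ⟨hmono, htie⟩ := Tuple.eq_sort_iff.mp (rfl : Tuple.sort f = Tuple.sort f)
  rw [mem_initialSegment]
  constructor
  · intro h
    by_contra! hst
    have h1 : f (Tuple.sort f t) ≤ f (Tuple.sort f s) := hmono hst.le
    have h2 := htie t s hst
    grind
  · intro hst
    rcases hst.eq_or_lt with rfl | hlt
    · exact Or.inr ⟨rfl, le_rfl⟩
    · have h1 : f (Tuple.sort f s) ≤ f (Tuple.sort f t) := hmono hst
      rcases h1.lt_or_eq with h | h
      · exact Or.inl h
      · exact Or.inr ⟨h, (htie s t hlt h).le⟩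

lemma sort_mem_prefixSet_iff {n : ℕ} (v b : Fin n → ℝ) (k : ℕ) (t : Fin n) :
    Tuple.sort (fun i => b i / v i) t ∈ prefixSet v b k ↔ (t : ℕ) < k := by
  simp [prefixSet]

lemma prefixSet_succ {n : ℕ} (v b : Fin n → ℝ) (t : Fin n) :
    prefixSet v b ((t : ℕ) + 1) =
      initialSegment (fun i => b i / v i) (Tuple.sort (fun i => b i / v i) t) := by
  ext w
  obtain ⟨s, rfl⟩ := (Tuple.sort (fun i => b i / v i)).surjective w
  rw [sort_mem_prefixSet_iff, sort_mem_initialSegment_iff, Fin.le_def]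
  omega

section CareCO

variable {n m L : ℕ} (g : Fin n → Fin L) (τ : Fin L → Fin m → ℕ) (v b : Fin n → ℝ) (B : ℝ)

lemma lt_keyIndex_iff (hρ : ∀ j, 0 < b j / v j) (t : Fin n) :
    (t : ℕ) < keyIndex g τ v b B ↔
      Tuple.sort (fun i => b i / v i) t ∈ affordable (Mv g τ v) B (fun i => b i / v i) := by
  classical
  have key : ∀ s : Fin n, nthRatio v b s * Mv g τ v (prefixSet v b ((s : ℕ) + 1)) ≤ B ↔
      Tuple.sort (fun i => b i / v i) s ∈ affordable (Mv g τ v) B (fun i => b i / v i) := by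
    intro s
    rw [prefixSet_succ, mem_affordable, nthRatio]
  constructor
  · intro h
    exact (key t).mp ((Finset.mem_filter.mp
      (Finset.max'_mem _ _ : keyIndex g τ v b B ∈ _)).2 t h)
  · intro h
    refine Nat.lt_of_succ_le (Finset.le_max' _ _ (Finset.mem_filter.mpr
      ⟨Finset.mem_range.mpr (by omega), fun s hs => (key s).mpr ?_⟩))
    exact affordable_of_mem_initialSegment (Mv_mono g τ v) (Mv_nonneg g τ v) hρ
      ((sort_mem_initialSegment_iff _ s t).mpr (Fin.le_def.mpr (by omega))) h

lemma prefixSet_keyIndex (hρ : ∀ j, 0 < b j / v j) :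
    prefixSet v b (keyIndex g τ v b B) = affordable (Mv g τ v) B (fun i => b i / v i) := by
  ext w
  obtain ⟨t, rfl⟩ := (Tuple.sort (fun i => b i / v i)).surjective w
  rw [sort_mem_prefixSet_iff, lt_keyIndex_iff g τ v b B hρ]

lemma careCoPrice_eq_unitPrice (hρ : ∀ j, 0 < b j / v j) :
    careCoPrice g τ v b B = unitPrice (Mv g τ v) B (fun i => b i / v i)
      (affordable (Mv g τ v) B (fun i => b i / v i)) := by
  rw [← prefixSet_keyIndex g τ v b B hρ]
  unfold careCoPrice unitPrice
  by_cases hk : keyIndex g τ v b B < n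
  · have hmem : Tuple.sort (fun i => b i / v i) ⟨_, hk⟩ ∈
        (prefixSet v b (keyIndex g τ v b B))ᶜ := by
      rw [Finset.mem_compl, sort_mem_prefixSet_iff]
      exact lt_irrefl _
    rw [dif_pos hk, dif_pos ⟨_, hmem⟩]
    congr 1
    refine le_antisymm (Finset.le_inf' _ _ fun w hw => ?_) (Finset.inf'_le _ hmem)
    obtain ⟨t, rfl⟩ := (Tuple.sort (fun i => b i / v i)).surjective w
    rw [Finset.mem_compl, sort_mem_prefixSet_iff, not_lt] at hw
    exact Tuple.monotone_sort (fun i => b i / v i) (Fin.le_def.mpr hw)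
  · rw [dif_neg hk, dif_neg]
    rintro ⟨w, hw⟩
    obtain ⟨t, rfl⟩ := (Tuple.sort (fun i => b i / v i)).surjective w
    rw [Finset.mem_compl, sort_mem_prefixSet_iff] at hw
    omega

end CareCO

/-- Truthfulness of CARE-CO (part of Theorem 1): fix positive reputations `v`, groups
`g`, thresholds `τ`, a pooled budget `B > 0`, and a bid-independent selector `F` that
maps every finite set `S` of workers to a compatibility-feasible assignment on `S` of
total reputation `Mv(S)`.  Then for every worker `i`, every true cost `c i > 0`, every
fixed positive profile of the other workers' bids, and every positive deviation `b i'`,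
the utility of `i` when bidding its true cost is at least its utility when deviating. -/
theorem careCO_truthful
    {n m L : ℕ} (g : Fin n → Fin L) (τ : Fin L → Fin m → ℕ)
    (v : Fin n → ℝ) (hv : ∀ i, 0 < v i) (B : ℝ) (hB : 0 < B)
    (F : Finset (Fin n) → (Fin n → Option (Fin m)))
    (hF : ∀ S : Finset (Fin n), CompatFeasible g τ S (F S) ∧
      ∑ i ∈ selected (F S), v i = Mv g τ v S)
    (i : Fin n) (ci : ℝ) (hci : 0 < ci)
    (b : Fin n → ℝ) (hb : ∀ j, 0 < b j)
    (bi' : ℝ) (hbi' : 0 < bi') :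
    careCoUtility g τ v F B (Function.update b i bi') i ci ≤
      careCoUtility g τ v F B (Function.update b i ci) i ci := by
  set M := Mv g τ v
  have hM : Monotone M := Mv_mono g τ v
  have hM0 : ∀ S, 0 ≤ M S := Mv_nonneg g τ v
  have hpos : ∀ x, 0 < x → ∀ j, 0 < Function.update b i x j / v j := fun x hx j => by
    refine div_pos ?_ (hv j)
    by_cases h : j = i
    · simpa [h] using hx
    · simpa [h] using hb j
  have hρ := hpos ci hci
  have hρ' := hpos bi' hbi'
  simp only [careCoUtility, prefixSet_keyIndex g τ v _ B hρ, prefixSet_keyIndex g τ v _ B hρ',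
    careCoPrice_eq_unitPrice g τ v _ B hρ, careCoPrice_eq_unitPrice g τ v _ B hρ']
  set ρ : Fin n → ℝ := fun j => Function.update b i ci j / v j with hρ_def
  set ρ' : Fin n → ℝ := fun j => Function.update b i bi' j / v j with hρ'_def
  have hne : ∀ j, j ≠ i → ρ' j = ρ j := fun j hj => by simp [hρ_def, hρ'_def, hj]
  have hci_eq : v i * ρ i = ci := by
    simp [hρ_def, mul_div_cancel₀ _ (hv i).ne']
  have hsel : ∀ S, i ∈ selected (F S) → i ∈ S ∧ 0 < M S := fun S h => by
    refine ⟨(hF S).1.1 i (Finset.mem_filter.mp h).2, ?_⟩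
    rw [← (hF S).2]
    exact Finset.sum_pos (fun j _ => hv j) ⟨i, h⟩
  by_cases hi : i ∈ affordable M B ρ
  · have hutil : 0 ≤ if i ∈ selected (F (affordable M B ρ)) then
        v i * unitPrice M B ρ (affordable M B ρ) - ci else 0 := by
      split_ifs with h
      · have := mul_le_mul_of_nonneg_left
          (le_unitPrice_of_mem_affordable hM hM0 hρ hi (hsel _ h).2) (hv i).le
        linarith
      · exact le_rfl
    by_cases hi' : i ∈ affordable M B ρ'
    · have hS : affordable M B ρ' = affordable M B ρ := by
        rcases le_total (ρ' i) (ρ i) with h | h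
        · exact affordable_eq_of_le hM hM0 hρ hne h hi
        · exact (affordable_eq_of_le hM hM0 hρ' (fun j hj => (hne j hj).symm) h hi').symm
      rw [hS, unitPrice_congr M B fun j hj => hne j fun h => hj (h ▸ hi)]
    · rwa [if_neg fun h => hi' (hsel _ h).1]
  · rw [if_neg (fun h => hi (hsel _ h).1 : i ∉ selected (F (affordable M B ρ)))]
    split_ifs with h
    · obtain ⟨hi', hpos'⟩ := hsel _ h
      have hle : unitPrice M B ρ' (affordable M B ρ') ≤ ρ i := by
        by_contra! hlt
        exact hi (mem_affordable_of_lt_unitPrice hM hρ hne hi' hpos' hlt)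
      have := mul_le_mul_of_nonneg_left hle (hv i).le
      linarith
    · exact le_rfl
end

section
/- (Decomposition bound for the optimal solution, intermediate claim in the proof of Theorem 1.) Assume the CARE-CO setup with truthful bids (bid = cost) and k < n, so that (b (k+1)/v (k+1))·M_v(S_{k+1}) > B. Then every compatibility-feasible assignment x on the full worker set with total selected cost ∑_{i selected} b i ≤ B satisfies ∑_{i selected} v i ≤ M_v(S_k) + M_v(S_{k+1}): the reputation contributed by selected workers with index ≤ k is at most M_v(S_k), and the reputation contributed by selected workers with index > k (all of whose cost-to-reputation ratios are at least b (k+1)/v (k+1)) is strictly less than M_v(S_{k+1}). -/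
/-- Restricting a feasible assignment to `S` keeps it feasible, so the reputation it collects
inside `S` is at most the optimum on `S`. -/
lemma sum_selected_filter_mem_le_Mv {n m L : ℕ} (g : Fin n → Fin L) (τ : Fin L → Fin m → ℕ)
    (v : Fin n → ℝ) (S T : Finset (Fin n)) (x : Fin n → Option (Fin m))
    (hx : CompatFeasible g τ T x) :
    ∑ i ∈ selected x with i ∈ S, v i ≤ Mv g τ v S := by
  classical
  let y : Fin n → Option (Fin m) := fun i => if i ∈ S then x i else none
  have hy : CompatFeasible g τ S y := by
    refine ⟨fun i hi => by_contra fun h => hi (if_neg h), fun l j => ?_⟩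
    refine (Finset.card_le_card fun i hi => ?_).trans (hx.2 l j)
    by_cases h : i ∈ S <;> simp_all [y]
  have hsel : selected y = {i ∈ selected x | i ∈ S} := by
    ext i
    by_cases h : i ∈ S <;> simp [selected, y, h]
  rw [← hsel]
  exact Finset.le_sup' (fun z : Fin n → Option (Fin m) => ∑ i ∈ selected z, v i)
    (Finset.mem_filter.mpr ⟨Finset.mem_univ y, hy⟩)

/-- If every worker of `A` has cost-to-reputation ratio at least `r`, then the reputation of `A`
weighted by `r` is at most the cost of `A`. -/
lemma mul_sum_le_sum_of_le_div {ι : Type*} (A : Finset ι) (b v : ι → ℝ) (r : ℝ)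
    (hv : ∀ i ∈ A, 0 < v i) (hr : ∀ i ∈ A, r ≤ b i / v i) :
    r * ∑ i ∈ A, v i ≤ ∑ i ∈ A, b i := by
  rw [Finset.mul_sum]
  exact Finset.sum_le_sum fun i hi => (le_div_iff₀ (hv i hi)).mp (hr i hi)

/-- Decomposition bound for the optimal solution (intermediate claim in the proof of
Theorem 1): in the CARE-CO setup with truthful bids and `k < n`, every
compatibility-feasible assignment on the full worker set with total selected cost at
most `B` obtains overall reputation at most `Mv(S_k) + Mv(S_{k+1})`. -/
theorem careCO_decomposition
    {n m L : ℕ} (g : Fin n → Fin L) (τ : Fin L → Fin m → ℕ)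
    (b v : Fin n → ℝ) (hb : ∀ i, 0 < b i) (hv : ∀ i, 0 < v i)
    (hsort : ∀ i i' : Fin n, i ≤ i' → b i / v i ≤ b i' / v i')
    (B : ℝ) (hB : 0 < B) (k : ℕ) (hk : k < n)
    (hkey₁ : ∀ i : Fin n, (i : ℕ) < k → b i / v i * Mv g τ v (firstWorkers n k) ≤ B)
    (hkey₂ : B < b ⟨k, hk⟩ / v ⟨k, hk⟩ * Mv g τ v (firstWorkers n (k + 1))) :
    ∀ x : Fin n → Option (Fin m), CompatFeasible g τ Finset.univ x →
      (∑ i ∈ selected x, b i) ≤ B →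
      ∑ i ∈ selected x, v i ≤
        Mv g τ v (firstWorkers n k) + Mv g τ v (firstWorkers n (k + 1)) := by
  intro x hx hcost
  rw [← Finset.sum_filter_add_sum_filter_not (selected x) (· ∈ firstWorkers n k)]
  refine add_le_add (sum_selected_filter_mem_le_Mv g τ v _ _ x hx) ?_
  refine le_of_mul_le_mul_left ?_ (div_pos (hb ⟨k, hk⟩) (hv ⟨k, hk⟩))
  calc b ⟨k, hk⟩ / v ⟨k, hk⟩ * ∑ i ∈ selected x with i ∉ firstWorkers n k, v i
      ≤ ∑ i ∈ selected x with i ∉ firstWorkers n k, b i := by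
        refine mul_sum_le_sum_of_le_div _ b v _ (fun i _ => hv i) fun i hi => hsort _ _ ?_
        simpa [firstWorkers, Fin.le_def] using (Finset.mem_filter.mp hi).2
    _ ≤ ∑ i ∈ selected x, b i :=
        Finset.sum_le_sum_of_subset_of_nonneg (Finset.filter_subset _ _) fun i _ _ => (hb i).le
    _ ≤ b ⟨k, hk⟩ / v ⟨k, hk⟩ * Mv g τ v (firstWorkers n (k + 1)) := hcost.trans hkey₂.le
end

section
/- (Lemma 3 of the paper.) In the capacitated count model, for every capacities c : Fin m → ℕ, every finite available set S of workers, and every worker s ∈ S, removing s decreases the optimal count by at most one: N_c(S \ {s}) ≥ N_c(S) − 1. -/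
/-- `x` is cap-feasible on `S` with capacities `c`: compatibility-feasible on `S` and
each requester `j` receives at most `c j` workers. -/
def CapFeasible {n m L : ℕ} (g : Fin n → Fin L) (τ : Fin L → Fin m → ℕ)
    (c : Fin m → ℕ) (S : Finset (Fin n)) (x : Fin n → Option (Fin m)) : Prop :=
  CompatFeasible g τ S x ∧
  ∀ j : Fin m, (Finset.univ.filter fun i => x i = some j).card ≤ c j

open Classical in
/-- `Nc g τ c S`: the maximum number of selected workers over cap-feasible assignments
on `S`. -/
noncomputable def Nc {n m L : ℕ} (g : Fin n → Fin L) (τ : Fin L → Fin m → ℕ)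
    (c : Fin m → ℕ) (S : Finset (Fin n)) : ℕ :=
  (Finset.univ.filter fun x : Fin n → Option (Fin m) => CapFeasible g τ c S x).sup
    fun x => (selected x).card
/-- Unassigning a worker keeps an assignment cap-feasible, on the set without that worker. -/
lemma CapFeasible.update_none {n m L : ℕ} {g : Fin n → Fin L} {τ : Fin L → Fin m → ℕ}
    {c : Fin m → ℕ} {S : Finset (Fin n)} {x : Fin n → Option (Fin m)}
    (hx : CapFeasible g τ c S x) (s : Fin n) :
    CapFeasible g τ c (S.erase s) (Function.update x s none) := by
  have of_update {i : Fin n} {j : Fin m} (h : Function.update x s none i = some j) :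
      x i = some j := by
    by_cases hi : i = s <;> simp_all
  refine ⟨⟨fun i hi => ?_, fun l j => ?_⟩, fun j => ?_⟩
  · by_cases his : i = s
    · simp [his] at hi
    · rw [Function.update_of_ne his] at hi
      exact Finset.mem_erase.mpr ⟨his, hx.1.1 i hi⟩
  · exact (Finset.card_le_card (Finset.monotone_filter_right _
      fun i _ h => ⟨h.1, of_update h.2⟩)).trans (hx.1.2 l j)
  · exact (Finset.card_le_card (Finset.monotone_filter_right _
      fun i _ h => of_update h)).trans (hx.2 j)

lemma selected_update_none {n m : ℕ} (x : Fin n → Option (Fin m)) (s : Fin n) :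
    selected (Function.update x s none) = (selected x).erase s := by
  ext i
  by_cases hi : i = s <;> simp [selected, hi]

lemma CapFeasible.card_selected_le_Nc {n m L : ℕ} {g : Fin n → Fin L} {τ : Fin L → Fin m → ℕ}
    {c : Fin m → ℕ} {S : Finset (Fin n)} {x : Fin n → Option (Fin m)}
    (hx : CapFeasible g τ c S x) : (selected x).card ≤ Nc g τ c S := by
  classical
  exact Finset.le_sup (f := fun x => (selected x).card)
    (Finset.mem_filter.mpr ⟨Finset.mem_univ x, hx⟩)

/-- Lemma 3 of the paper: in the capacitated count model, removing a worker `s ∈ S` from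
the available set decreases the optimal count by at most one:
`N_c(S \ {s}) ≥ N_c(S) − 1`. -/
theorem Nc_erase_ge
    {n m L : ℕ} (g : Fin n → Fin L) (τ : Fin L → Fin m → ℕ)
    (c : Fin m → ℕ) (S : Finset (Fin n)) (s : Fin n) (hs : s ∈ S) :
    Nc g τ c S - 1 ≤ Nc g τ c (S.erase s) := by
  classical
  rw [Nat.sub_le_iff_le_add]
  refine Finset.sup_le fun x hx => ?_
  have h := ((Finset.mem_filter.mp hx).2.update_none s).card_selected_le_Nc
  rw [selected_update_none] at h
  have := (selected x).pred_card_le_card_erase (a := s)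
  omega
end

section
/- (Strict monotonicity of employability at virtual prices, supporting claim in the proof of Lemma 2.) Let m ≥ 1 and let B_j > 0 be real budgets for j ∈ Fin m. Let 0 < r₁ < r₂ be reals such that r₁ = B_{j'} / t' for some requester j' and some positive integer t'. Then the employability strictly decreases: ∑_{j} ⌊B_j / r₁⌋ > ∑_{j} ⌊B_j / r₂⌋. -/
/-- Strict monotonicity of employability at virtual prices (supporting claim in the
proof of Lemma 2): for positive budgets `B_j` (`j ∈ Fin m`, `m ≥ 1`) and reals
`0 < r₁ < r₂` such that `r₁ = B_{j'} / t'` for some requester `j'` and positive integer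
`t'`, the employability strictly decreases: `∑_j ⌊B_j / r₁⌋ > ∑_j ⌊B_j / r₂⌋`. -/
theorem employability_strict_decrease
    {m : ℕ} (hm : 1 ≤ m) (B : Fin m → ℝ) (hB : ∀ j, 0 < B j)
    (r₁ r₂ : ℝ) (hr₁ : 0 < r₁) (h₁₂ : r₁ < r₂)
    (j' : Fin m) (t' : ℕ) (ht' : 0 < t') (hr : r₁ = B j' / (t' : ℝ)) :
    ∑ j : Fin m, ⌊B j / r₂⌋ < ∑ j : Fin m, ⌊B j / r₁⌋ := by
  have h_eq : B j' / r₁ = ((t' : ℤ) : ℝ) := by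
    rw [hr, div_div_cancel₀ (hB j').ne']
    simp
  refine Finset.sum_lt_sum (fun j _ => ?_) ⟨j', Finset.mem_univ j', ?_⟩
  · exact Int.floor_le_floor (div_le_div_of_nonneg_left (hB j).le hr₁ h₁₂.le)
  · rw [h_eq, Int.floor_intCast, Int.floor_lt, ← h_eq]
    exact div_lt_div_of_pos_left (hB j') hr₁ h₁₂
end

section
/- (Combinatorial core of Lemma 1 of the paper: stability of the minimum-binary-weight winner set under a bid decrease.) Let F be a nonempty finite family of finite sets of natural numbers. Define weights w t = 2^t. Suppose S₀ ∈ F is the strict minimizer of S ↦ ∑_{t ∈ S} w t over F, i.e. ∑_{t ∈ S₀} 2^t < ∑_{t ∈ S} 2^t for every S ∈ F with S ≠ S₀. Let i ∈ S₀ and let l be a natural number with l + 1 ≤ i. Define new weights w' by: w' t = 2^{t+1} if l + 1 ≤ t ≤ i − 1, w' i = 2^{l+1}, and w' t = 2^t for all other t. Then every S' ∈ F minimizing S ↦ ∑_{t ∈ S} w' t over F contains i. (In the paper, F is the family of feasible winner sets of size M_f(r*) drawn from S(r*), the original weights encode the workers' bid order, and the reweighting w' encodes winner s_i lowering its bid from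 rank i to rank l + 1; the conclusion is that s_i remains a winner.) -/
theorem sum_Ico_two_pow_add {a b : ℕ} (h : a ≤ b) :
    ∑ t ∈ Finset.Ico a b, 2 ^ t + 2 ^ a = 2 ^ b := by
  induction b, h using Nat.le_induction with
  | base => simp
  | succ b hb ih =>
    rw [Finset.sum_Ico_succ_top hb, pow_succ]
    omega

/-- Combinatorial core of Lemma 1 of the paper: stability of the minimum-binary-weight
winner set under a bid decrease.  Let `F` be a nonempty finite family of finite sets of
naturals, with weights `w t = 2^t`, and let `S₀ ∈ F` be the strict minimizer of the
total weight.  Let `i ∈ S₀` and `l + 1 ≤ i`, and reweight: `w' t = 2^(t+1)` for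
`l + 1 ≤ t ≤ i − 1`, `w' i = 2^(l+1)`, and `w' t = 2^t` otherwise.  Then every member of
`F` minimizing the total `w'`-weight over `F` contains `i`. -/
theorem minWeight_winner_stable
    (F : Finset (Finset ℕ)) (hF : F.Nonempty)
    (S₀ : Finset ℕ) (hS₀ : S₀ ∈ F)
    (hmin : ∀ S ∈ F, S ≠ S₀ → ∑ t ∈ S₀, 2 ^ t < ∑ t ∈ S, 2 ^ t)
    (i : ℕ) (hi : i ∈ S₀) (l : ℕ) (hl : l + 1 ≤ i)
    (w' : ℕ → ℕ)
    (hw' : ∀ t, w' t = if t = i then 2 ^ (l + 1)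
      else if l + 1 ≤ t ∧ t ≤ i - 1 then 2 ^ (t + 1) else 2 ^ t) :
    ∀ S' ∈ F, (∀ S ∈ F, ∑ t ∈ S', w' t ≤ ∑ t ∈ S, w' t) → i ∈ S' := by
  intro S' hS' hle
  by_contra hiS'
  have hne : S' ≠ S₀ := by
    rintro rfl
    exact hiS' hi
  have hge : ∑ t ∈ S', 2 ^ t ≤ ∑ t ∈ S', w' t := by
    refine Finset.sum_le_sum fun t ht => ?_
    have hti : t ≠ i := by
      rintro rfl
      exact hiS' ht
    rw [hw', if_neg hti]
    split_ifs
    · exact Nat.pow_le_pow_right two_pos t.le_succ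
    · exact le_rfl
  have hrest : ∑ t ∈ S₀.erase i, w' t
      ≤ ∑ t ∈ S₀.erase i, 2 ^ t + ∑ t ∈ Finset.Ico (l + 1) i, 2 ^ t := by
    have hpt : ∀ t ∈ S₀.erase i,
        w' t = 2 ^ t + if t ∈ Finset.Ico (l + 1) i then 2 ^ t else 0 := by
      intro t ht
      rw [hw', if_neg (Finset.ne_of_mem_erase ht)]
      simp only [Finset.mem_Ico, pow_succ]
      split_ifs <;> omega
    rw [Finset.sum_congr rfl hpt, Finset.sum_add_distrib, ← Finset.sum_filter]
    gcongr
    intro t ht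
    exact (Finset.mem_filter.mp ht).2
  have hgeom := sum_Ico_two_pow_add hl
  have hwi : w' i = 2 ^ (l + 1) := by rw [hw', if_pos rfl]
  have hsum := Finset.sum_erase_add S₀ w' hi
  have hsum_pow := Finset.sum_erase_add S₀ (fun t => 2 ^ t) hi
  have hlt := hmin S' hS' hne
  have hle₀ := hle S₀ hS₀
  omega
end

section
/- (Employability gap between adjacent virtual prices is at most the number of requesters.) Let B_j > 0 be real budgets for j ∈ Fin m and let R = { B_j / t : j ∈ Fin m, t a positive integer }. Suppose r₁, r₂ ∈ R with r₁ < r₂ and no element of R lies strictly between r₁ and r₂. Then ∑_{j} ⌊B_j / r₁⌋ − ∑_{j} ⌊B_j / r₂⌋ ≤ m; that is, each requester's floor ⌊B_j / r⌋ drops by at most one between two adjacent virtual prices, so the employability drops by at most m. -/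
/-- If no fraction `b / t` with `t` a positive integer lies strictly between `r₁` and `r₂`, then
`⌊b / r⌋` drops by at most one from `r₁` to `r₂`. -/
theorem floor_div_le_floor_div_add_one {b r₁ r₂ : ℝ} (hb : 0 ≤ b) (hr₁ : 0 < r₁) (hr₂ : 0 < r₂)
    (hgap : ∀ t : ℕ, 0 < t → ¬(r₁ < b / t ∧ b / t < r₂)) :
    ⌊b / r₁⌋ ≤ ⌊b / r₂⌋ + 1 := by
  by_contra! hlt
  obtain ⟨n, hn⟩ := Int.eq_ofNat_of_zero_le (Int.floor_nonneg.2 (div_nonneg hb hr₂.le))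
  have hupper : b / r₂ < (n : ℝ) + 1 := by
    have := Int.lt_floor_add_one (b / r₂)
    rw [hn] at this
    exact_mod_cast this
  have hlower : (n : ℝ) + 2 ≤ b / r₁ := by
    have : ((n + 2 : ℤ) : ℝ) ≤ b / r₁ := Int.le_floor.1 (by omega)
    exact_mod_cast this
  rw [div_lt_iff₀ hr₂] at hupper
  rw [le_div_iff₀ hr₁] at hlower
  have hpos : (0 : ℝ) < (n : ℝ) + 1 := by positivity
  refine hgap (n + 1) n.succ_pos ?_
  push_cast
  rw [lt_div_iff₀ hpos, div_lt_iff₀ hpos]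
  constructor <;> linarith

/-- Employability gap between adjacent virtual prices is at most the number of
requesters: for positive budgets `B_j` (`j ∈ Fin m`), letting
`R = {B_j / t : j ∈ Fin m, t a positive integer}`, if `r₁ < r₂` are elements of `R` with
no element of `R` strictly between them, then
`∑_j ⌊B_j / r₁⌋ − ∑_j ⌊B_j / r₂⌋ ≤ m`. -/
theorem employability_adjacent_gap
    {m : ℕ} (B : Fin m → ℝ) (hB : ∀ j, 0 < B j)
    (R : Set ℝ) (hR : R = {r : ℝ | ∃ j : Fin m, ∃ t : ℕ, 0 < t ∧ r = B j / (t : ℝ)})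
    (r₁ r₂ : ℝ) (h₁ : r₁ ∈ R) (h₂ : r₂ ∈ R) (h₁₂ : r₁ < r₂)
    (hadj : ∀ r ∈ R, ¬(r₁ < r ∧ r < r₂)) :
    (∑ j : Fin m, ⌊B j / r₁⌋) - (∑ j : Fin m, ⌊B j / r₂⌋) ≤ (m : ℤ) := by
  subst hR
  have hr₁ : 0 < r₁ := by
    obtain ⟨j, t, ht, rfl⟩ := h₁
    exact div_pos (hB j) (Nat.cast_pos.2 ht)
  have hsum : ∑ j : Fin m, ⌊B j / r₁⌋ ≤ ∑ j : Fin m, (⌊B j / r₂⌋ + 1) :=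
    Finset.sum_le_sum fun j _ =>
      floor_div_le_floor_div_add_one (hB j).le hr₁ (hr₁.trans h₁₂)
        fun t ht => hadj _ ⟨j, t, ht, rfl⟩
  simp only [Finset.sum_add_distrib, Finset.sum_const, Finset.card_univ, Fintype.card_fin,
    nsmul_eq_mul, mul_one] at hsum
  linarith
end
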